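/- arXiv:1905.11768 — 4 statements merged into one kernel-verified Lean document; each statement's English description precedes it below -/
import Mathlib

section
/- Let d ≥ 1, let g₁, …, g_n : ℝ^d → ℝ be convex functions, let γ > 0, and let a, y₀, y₁, …, y_n ∈ ℝ^d be such that for every k = 1, …, n, y_k is a minimizer over ℝ^d of the map y ↦ g_k(y) + ‖y − y_{k−1}‖²/(2γ) (i.e. y_k = prox_{γ g_k}(y_{k−1})). Then ‖y_n − a‖² ≤ ‖y₀ − a‖² − 2γ Σ_{k=1}^n ( g_k^γ(y_{k−1}) − g_k(a) ), where g^γ(x) := inf_{y ∈ ℝ^d} ( g(y) + ‖y − x‖²/(2γ) ) denotes the Moreau envelope. -/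
/-- The squared norm of a convex combination, relative to a base point. -/
theorem norm_sq_convexComb_sub {E : Type*} [NormedAddCommGroup E] [InnerProductSpace ℝ E]
    (p z x : E) (t : ℝ) :
    ‖(1 - t) • p + t • z - x‖ ^ 2 =
      (1 - t) * ‖p - x‖ ^ 2 + t * ‖z - x‖ ^ 2 - t * (1 - t) * ‖p - z‖ ^ 2 := by
  have h₁ : (1 - t) • p + t • z - x = (1 - t) • (p - x) + t • (z - x) := by module
  have h₂ : p - z = (p - x) - (z - x) := by abel
  rw [h₁, h₂, norm_add_sq_real, norm_sub_sq_real (p - x) (z - x), norm_smul, norm_smul, mul_pow, mul_pow,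
    inner_smul_left, inner_smul_right]
  simp only [Real.norm_eq_abs, sq_abs, conj_trivial]
  ring

/-- The three-point inequality for a minimizer `p` of `z ↦ g z + ‖z - x‖² / (2γ)`. -/
theorem ConvexOn.add_norm_sq_le_of_prox {E : Type*} [NormedAddCommGroup E]
    [InnerProductSpace ℝ E] {g : E → ℝ} (hg : ConvexOn ℝ Set.univ g) {γ : ℝ} {x p : E}
    (hp : ∀ z, g p + ‖p - x‖ ^ 2 / (2 * γ) ≤ g z + ‖z - x‖ ^ 2 / (2 * γ)) (z : E) :
    g p + ‖p - x‖ ^ 2 / (2 * γ) + ‖p - z‖ ^ 2 / (2 * γ) ≤ g z + ‖z - x‖ ^ 2 / (2 * γ) := by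
  have key : ∀ t ∈ Set.Ioo (0 : ℝ) 1,
      g p + ‖p - x‖ ^ 2 / (2 * γ) + (1 - t) * (‖p - z‖ ^ 2 / (2 * γ)) ≤
        g z + ‖z - x‖ ^ 2 / (2 * γ) := by
    rintro t ⟨ht₀, ht₁⟩
    have h₁ := hp ((1 - t) • p + t • z)
    have h₂ := hg.2 (Set.mem_univ p) (Set.mem_univ z) (sub_nonneg.2 ht₁.le) ht₀.le
      (sub_add_cancel 1 t)
    rw [norm_sq_convexComb_sub] at h₁
    simp only [smul_eq_mul] at h₂
    refine le_of_mul_le_mul_left ?_ ht₀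
    simp only [div_eq_mul_inv] at h₁ ⊢
    linarith
  have hlim : Filter.Tendsto
      (fun t : ℝ => g p + ‖p - x‖ ^ 2 / (2 * γ) + (1 - t) * (‖p - z‖ ^ 2 / (2 * γ)))
      (nhdsWithin 0 (Set.Ioi 0))
      (nhds (g p + ‖p - x‖ ^ 2 / (2 * γ) + (1 - 0) * (‖p - z‖ ^ 2 / (2 * γ)))) :=
    (Continuous.tendsto (by fun_prop) 0).mono_left nhdsWithin_le_nhds
  have h := le_of_tendsto hlim
    (Filter.mem_of_superset (Ioo_mem_nhdsGT zero_lt_one) key)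
  simpa using h

/-- If `y_k = prox_{γ g_k}(y_{k-1})` (i.e. `y_k` minimizes
`y ↦ g_k y + ‖y - y_{k-1}‖²/(2γ)`) for `k = 1, …, n`, with each `g_k` convex, then
`‖y_n - a‖² ≤ ‖y_0 - a‖² - 2γ Σ_{k=1}^n (g_k^γ(y_{k-1}) - g_k(a))`, where
`g^γ(x) := ⨅ y, (g y + ‖y - x‖²/(2γ))` is the Moreau envelope. -/
theorem norm_sq_prox_chain_le
    (d n : ℕ) (hd : 1 ≤ d)
    (g : ℕ → EuclideanSpace ℝ (Fin d) → ℝ)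
    (hg : ∀ k ∈ Finset.Icc 1 n, ConvexOn ℝ Set.univ (g k))
    (γ : ℝ) (hγ : 0 < γ)
    (a : EuclideanSpace ℝ (Fin d)) (y : ℕ → EuclideanSpace ℝ (Fin d))
    (hy : ∀ k ∈ Finset.Icc 1 n, ∀ z,
      g k (y k) + ‖y k - y (k - 1)‖ ^ 2 / (2 * γ) ≤ g k z + ‖z - y (k - 1)‖ ^ 2 / (2 * γ)) :
    ‖y n - a‖ ^ 2 ≤ ‖y 0 - a‖ ^ 2 -
      2 * γ * ∑ k ∈ Finset.Icc 1 n,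
        ((⨅ z : EuclideanSpace ℝ (Fin d), (g k z + ‖z - y (k - 1)‖ ^ 2 / (2 * γ))) - g k a) := by
  induction n with
  | zero => simp
  | succ n ih =>
    have hsub := Finset.Icc_subset_Icc_right (a := 1) n.le_succ
    have ih' := ih (fun k hk => hg k (hsub hk)) (fun k hk => hy k (hsub hk))
    have hmem : n + 1 ∈ Finset.Icc 1 (n + 1) := by simp
    have hmin := hy _ hmem
    have hstep := (hg _ hmem).add_norm_sq_le_of_prox hmin a
    have hinf : (⨅ z, (g (n + 1) z + ‖z - y (n + 1 - 1)‖ ^ 2 / (2 * γ))) ≤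
        g (n + 1) (y (n + 1)) + ‖y (n + 1) - y (n + 1 - 1)‖ ^ 2 / (2 * γ) :=
      ciInf_le ⟨_, Set.forall_mem_range.2 hmin⟩ (y (n + 1))
    rw [Finset.sum_Icc_succ_top (by omega), mul_add]
    simp only [Nat.add_sub_cancel] at hstep hinf ⊢
    rw [norm_sub_rev a] at hstep
    have h := mul_le_mul_of_nonneg_left (add_le_add hinf hstep) (by positivity : 0 ≤ 2 * γ)
    have e₁ : 2 * γ * (‖y (n + 1) - a‖ ^ 2 / (2 * γ)) = ‖y (n + 1) - a‖ ^ 2 := by field_simp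
    have e₂ : 2 * γ * (‖y n - a‖ ^ 2 / (2 * γ)) = ‖y n - a‖ ^ 2 := by field_simp
    simp only [mul_add] at h
    linarith
end

section
/- Let d ≥ 1, let g₁, …, g_n : ℝ^d → ℝ be convex, let γ > 0, and let a, y₀, y₁, …, y_n ∈ ℝ^d with y_i = prox_{γ g_i}(y_{i−1}) for i = 1, …, n. For each i let d_i ∈ ℝ^d be a subgradient of g_i at y₀, and let p_i = prox_{γ g_i}(y₀). Then ‖y_n − a‖² ≤ ‖y₀ − a‖² − 2γ Σ_{i=1}^n ( g_i(y₀) − g_i(a) ) + γ² Σ_{i=1}^n ‖d_i‖² + Σ_{i=2}^n ( (i−1)‖y₀ − p_i‖² + Σ_{j=1}^{i−1} ‖y_j − y_{j−1}‖² ). -/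
open scoped InnerProductSpace

/-- The three-point inequality satisfied by a proximal point of a convex function. -/
theorem ConvexOn.two_mul_sub_le_of_prox {E : Type*} [NormedAddCommGroup E]
    [InnerProductSpace ℝ E] {f : E → ℝ} (hf : ConvexOn ℝ Set.univ f) {γ : ℝ} (hγ : 0 < γ)
    {x p : E} (hp : ∀ z, f p + ‖p - x‖ ^ 2 / (2 * γ) ≤ f z + ‖z - x‖ ^ 2 / (2 * γ)) (z : E) :
    2 * γ * (f p - f z) ≤ ‖x - z‖ ^ 2 - ‖p - z‖ ^ 2 - ‖p - x‖ ^ 2 := by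
  have key : ∀ t ∈ Set.Ioo (0 : ℝ) 1,
      2 * γ * (f p - f z) ≤ 2 * ⟪p - x, z - p⟫_ℝ + t * ‖z - p‖ ^ 2 := by
    rintro t ⟨ht0, ht1⟩
    have h₁ := hp ((1 - t) • p + t • z)
    have h₂ := hf.2 (Set.mem_univ p) (Set.mem_univ z) (sub_nonneg.2 ht1.le) ht0.le
      (sub_add_cancel 1 t)
    rw [smul_eq_mul, smul_eq_mul] at h₂
    have h₃ : ‖(1 - t) • p + t • z - x‖ ^ 2
        = ‖p - x‖ ^ 2 + 2 * (t * ⟪p - x, z - p⟫_ℝ) + t ^ 2 * ‖z - p‖ ^ 2 := by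
      have h : (1 - t) • p + t • z - x = (p - x) + t • (z - p) := by module
      rw [h, norm_add_sq_real, real_inner_smul_right, norm_smul, mul_pow, Real.norm_eq_abs, sq_abs]
    rw [h₃] at h₁
    have h₄ : ∀ c : ℝ, 2 * γ * (c / (2 * γ)) = c := fun c => by field_simp
    have h₅ := mul_le_mul_of_nonneg_left
      (h₁.trans (add_le_add_left h₂ _)) (mul_pos two_pos hγ).le
    rw [mul_add, mul_add, h₄, h₄] at h₅
    refine le_of_mul_le_mul_left ?_ ht0
    linarith
  have lim : Filter.Tendsto (fun t : ℝ => 2 * ⟪p - x, z - p⟫_ℝ + t * ‖z - p‖ ^ 2)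
      (nhdsWithin 0 (Set.Ioi 0)) (nhds (2 * ⟪p - x, z - p⟫_ℝ)) := by
    have h : Continuous fun t : ℝ => 2 * ⟪p - x, z - p⟫_ℝ + t * ‖z - p‖ ^ 2 := by fun_prop
    simpa using (h.tendsto 0).mono_left nhdsWithin_le_nhds
  have h := ge_of_tendsto lim (Filter.mem_of_superset (Ioo_mem_nhdsGT one_pos) key)
  have e : ‖x - z‖ ^ 2 = ‖p - x‖ ^ 2 + 2 * ⟪p - x, z - p⟫_ℝ + ‖p - z‖ ^ 2 := by
    rw [norm_sub_rev x z, norm_sub_rev p z, ← norm_add_sq_real]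
    congr 2
    abel
  linarith

/-- The Moreau envelope, evaluated along `w` at `x`, lies above its tangent at `x₀`, which in turn
is controlled by a subgradient `v` at `x₀`. -/
theorem ConvexOn.le_prox_value_add_norm_sq {E : Type*} [NormedAddCommGroup E]
    [InnerProductSpace ℝ E] {f : E → ℝ} (hf : ConvexOn ℝ Set.univ f) {γ : ℝ} (hγ : 0 < γ)
    {x₀ p v : E} (hp : ∀ z, f p + ‖p - x₀‖ ^ 2 / (2 * γ) ≤ f z + ‖z - x₀‖ ^ 2 / (2 * γ))
    (hv : ∀ z, f x₀ + ⟪v, z - x₀⟫_ℝ ≤ f z) (x w : E) :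
    2 * γ * f x₀ - γ ^ 2 * ‖v‖ ^ 2 + 2 * ⟪x₀ - p, x - x₀⟫_ℝ ≤ 2 * γ * f w + ‖w - x‖ ^ 2 := by
  have h₁ := hf.two_mul_sub_le_of_prox hγ hp w
  have h₂ := mul_le_mul_of_nonneg_left (hv p) (mul_pos two_pos hγ).le
  have h₃ : 0 ≤ ‖γ • v + (p - x₀)‖ ^ 2 := sq_nonneg _
  rw [norm_add_sq_real, real_inner_smul_left, norm_smul, mul_pow, Real.norm_eq_abs, sq_abs] at h₃
  have h₄ : ‖(w - x) - (p - x₀)‖ ^ 2 = ‖w - x‖ ^ 2 - ‖x₀ - w‖ ^ 2 + ‖p - w‖ ^ 2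
      - 2 * ⟪x₀ - p, x - x₀⟫_ℝ := by
    simp only [← real_inner_self_eq_norm_sq, inner_sub_left, inner_sub_right]
    rw [real_inner_comm w x, real_inner_comm w p, real_inner_comm w x₀, real_inner_comm x p,
      real_inner_comm x x₀, real_inner_comm p x₀]
    ring
  have h₅ := sq_nonneg ‖(w - x) - (p - x₀)‖
  rw [h₄] at h₅
  linarith

theorem neg_two_mul_inner_sub_le_sum {E : Type*} [NormedAddCommGroup E]
    [InnerProductSpace ℝ E] (u : E) (y : ℕ → E) (m : ℕ) :
    -(2 * ⟪u, y m - y 0⟫_ℝ) ≤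
      m * ‖u‖ ^ 2 + ∑ j ∈ Finset.Icc 1 m, ‖y j - y (j - 1)‖ ^ 2 := by
  induction m with
  | zero => simp
  | succ m ih =>
    rw [Finset.sum_Icc_succ_top (Nat.le_add_left 1 m), Nat.add_sub_cancel, Nat.cast_succ,
      ← sub_add_sub_cancel (y (m + 1)) (y m) (y 0), inner_add_right]
    have h := sq_nonneg ‖u + (y (m + 1) - y m)‖
    rw [norm_add_sq_real] at h
    linarith

/-- With `y_i = prox_{γ g_i}(y_{i-1})`, `d_i` a subgradient of `g_i` at `y_0`,
and `p_i = prox_{γ g_i}(y_0)`, one has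
`‖y_n - a‖² ≤ ‖y_0 - a‖² - 2γ Σ_{i=1}^n (g_i(y_0) - g_i(a)) + γ² Σ_{i=1}^n ‖d_i‖²
  + Σ_{i=2}^n ((i-1)‖y_0 - p_i‖² + Σ_{j=1}^{i-1} ‖y_j - y_{j-1}‖²)`. -/
theorem norm_sq_prox_chain_le_of_subgradients
    (d n : ℕ) (hd : 1 ≤ d)
    (g : ℕ → EuclideanSpace ℝ (Fin d) → ℝ)
    (hg : ∀ i ∈ Finset.Icc 1 n, ConvexOn ℝ Set.univ (g i))
    (γ : ℝ) (hγ : 0 < γ)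
    (a : EuclideanSpace ℝ (Fin d))
    (y dsub p : ℕ → EuclideanSpace ℝ (Fin d))
    (hy : ∀ i ∈ Finset.Icc 1 n, ∀ z,
      g i (y i) + ‖y i - y (i - 1)‖ ^ 2 / (2 * γ) ≤ g i z + ‖z - y (i - 1)‖ ^ 2 / (2 * γ))
    (hdsub : ∀ i ∈ Finset.Icc 1 n, ∀ z, g i (y 0) + ⟪dsub i, z - y 0⟫_ℝ ≤ g i z)
    (hp : ∀ i ∈ Finset.Icc 1 n, ∀ z,
      g i (p i) + ‖p i - y 0‖ ^ 2 / (2 * γ) ≤ g i z + ‖z - y 0‖ ^ 2 / (2 * γ)) :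
    ‖y n - a‖ ^ 2 ≤ ‖y 0 - a‖ ^ 2
      - 2 * γ * ∑ i ∈ Finset.Icc 1 n, (g i (y 0) - g i a)
      + γ ^ 2 * ∑ i ∈ Finset.Icc 1 n, ‖dsub i‖ ^ 2
      + ∑ i ∈ Finset.Icc 2 n,
          (((i : ℝ) - 1) * ‖y 0 - p i‖ ^ 2 + ∑ j ∈ Finset.Icc 1 (i - 1), ‖y j - y (j - 1)‖ ^ 2) := by
  have step : ∀ i ∈ Finset.Icc 1 n, ‖y i - a‖ ^ 2 - ‖y (i - 1) - a‖ ^ 2 ≤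
      -(2 * γ * (g i (y 0) - g i a)) + γ ^ 2 * ‖dsub i‖ ^ 2 + (((i : ℝ) - 1) * ‖y 0 - p i‖ ^ 2
        + ∑ j ∈ Finset.Icc 1 (i - 1), ‖y j - y (j - 1)‖ ^ 2) := by
    intro i hi
    have h₁ := (hg i hi).two_mul_sub_le_of_prox hγ (hy i hi) a
    have h₂ := (hg i hi).le_prox_value_add_norm_sq hγ (hp i hi) (hdsub i hi) (y (i - 1)) (y i)
    have h₃ := neg_two_mul_inner_sub_le_sum (y 0 - p i) y (i - 1)
    rw [Nat.cast_sub (Finset.mem_Icc.1 hi).1, Nat.cast_one] at h₃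
    linarith
  have tele : ∀ m, ∑ i ∈ Finset.Icc 1 m, (‖y i - a‖ ^ 2 - ‖y (i - 1) - a‖ ^ 2)
      = ‖y m - a‖ ^ 2 - ‖y 0 - a‖ ^ 2 := by
    intro m
    induction m with
    | zero => simp
    | succ m ih =>
      rw [Finset.sum_Icc_succ_top (Nat.le_add_left 1 m), ih, Nat.add_sub_cancel]
      ring
  have first : ∑ i ∈ Finset.Icc 2 n, (((i : ℝ) - 1) * ‖y 0 - p i‖ ^ 2
        + ∑ j ∈ Finset.Icc 1 (i - 1), ‖y j - y (j - 1)‖ ^ 2)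
      = ∑ i ∈ Finset.Icc 1 n, (((i : ℝ) - 1) * ‖y 0 - p i‖ ^ 2
        + ∑ j ∈ Finset.Icc 1 (i - 1), ‖y j - y (j - 1)‖ ^ 2) := by
    refine Finset.sum_subset (Finset.Icc_subset_Icc_left one_le_two) fun i hi hi' => ?_
    obtain rfl : i = 1 := by
      simp only [Finset.mem_Icc] at hi hi'
      omega
    simp
  have h := Finset.sum_le_sum step
  rw [tele, Finset.sum_add_distrib, Finset.sum_add_distrib, Finset.sum_neg_distrib,
    ← Finset.mul_sum, ← Finset.mul_sum] at h
  rw [first]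
  linarith
end

section
/- Let d ≥ 1 and let U : ℝ^d → ℝ be convex (hence continuous) with Z := ∫_{ℝ^d} exp(−U(x)) dx < ∞, and let μ* be the probability measure on ℝ^d with density exp(−U(x))/Z with respect to Lebesgue measure λ. Then: (i) μ* has finite second moment; (ii) ∫ U dμ* is finite and the entropy H(μ*) := ∫ log( dμ*/dλ ) dμ* is finite; (iii) for every probability measure ρ on ℝ^d with finite second moment that is absolutely continuous with respect to λ and satisfies ∫ U dρ < ∞, one has KL(ρ | μ*) = ( ∫ U dρ + H(ρ) ) − ( ∫ U dμ* + H(μ*) ), where H(ρ) := ∫ log( dρ/dλ ) dρ ∈ (−∞, +∞] and KL(ρ | μ*) := ∫ log( dρ/dμ* ) dρ. -/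
open MeasureTheory
open scoped Classical

/-- The entropy `H(ρ) := ∫ log(dρ/dλ) dρ` of a measure `ρ` on `ℝ^d` relative to Lebesgue
measure, as an extended real number: the Bochner integral if the integrand is `ρ`-integrable,
and `+∞` otherwise (the relevant entropies take values in `(-∞, +∞]`). -/
noncomputable def entropyE {d : ℕ} (ρ : Measure (EuclideanSpace ℝ (Fin d))) : EReal :=
  if Integrable (fun x => Real.log ((ρ.rnDeriv volume x).toReal)) ρ then
    ((∫ x, Real.log ((ρ.rnDeriv volume x).toReal) ∂ρ : ℝ) : EReal)
  else ⊤

/-- The Kullback–Leibler divergence `KL(ρ | ν) := ∫ log(dρ/dν) dρ` as an extended real number: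
`+∞` if `ρ` is not absolutely continuous w.r.t. `ν` or if the integrand fails to be
`ρ`-integrable. -/
noncomputable def klE {E : Type*} [MeasurableSpace E] (ρ ν : Measure E) : EReal :=
  if ρ ≪ ν ∧ Integrable (fun x => Real.log ((ρ.rnDeriv ν x).toReal)) ρ then
    ((∫ x, Real.log ((ρ.rnDeriv ν x).toReal) ∂ρ : ℝ) : EReal)
  else ⊤

section Growth

open Filter Topology Module

variable {E : Type*} [NormedAddCommGroup E] [NormedSpace ℝ E] [FiniteDimensional ℝ E]
  [MeasurableSpace E] [BorelSpace E] (μ : Measure E) [μ.IsAddHaarMeasure]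

/-- A convex set of finite Haar measure that is a neighbourhood of the origin is bounded. -/
theorem Convex.isBounded_of_measure_lt_top {K : Set E} (hK : Convex ℝ K) (h0 : K ∈ 𝓝 0)
    (hKm : MeasurableSet K) (hfin : μ K < ⊤) : Bornology.IsBounded K := by
  obtain ⟨r, hr, hball⟩ := Metric.mem_nhds_iff.1 h0
  have : IsFiniteMeasure (μ.restrict K) := ⟨by simpa using hfin⟩
  have hpos : 0 < μ (Metric.ball (0 : E) (r / 2)) := Metric.measure_ball_pos μ _ (by positivity)
  obtain ⟨ε, hε, hεlt⟩ := exists_between hpos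
  obtain ⟨C, hC, hCε⟩ := isTightMeasureSet_iff_exists_isCompact_measure_compl_le.1
    (isTightMeasureSet_singleton (μ := μ.restrict K)) ε hε
  obtain ⟨R, hR⟩ := hC.isBounded.subset_closedBall 0
  refine (Metric.isBounded_closedBall (x := (0 : E)) (r := 2 * R + r)).subset fun x hx => ?_
  rw [mem_closedBall_zero_iff]
  by_contra! hlt
  -- the half-size ball around `x / 2` lies in `K` and avoids `C`
  have hsubK : Metric.ball ((1 / 2 : ℝ) • x) (r / 2) ⊆ K := by
    intro y hy
    have hz : (2 : ℝ) • (y - (1 / 2 : ℝ) • x) ∈ K := by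
      apply hball
      rw [mem_ball_zero_iff, norm_smul, Real.norm_ofNat]
      rw [mem_ball_iff_norm] at hy
      linarith
    have h := hK hx hz (a := 1 / 2) (b := 1 / 2) (by norm_num) (by norm_num) (by norm_num)
    simpa [smul_smul] using h
  have hsubC : Metric.ball ((1 / 2 : ℝ) • x) (r / 2) ⊆ Cᶜ := by
    intro y hy hyC
    have h1 := hR hyC
    rw [mem_closedBall_zero_iff] at h1
    rw [mem_ball_iff_norm'] at hy
    have h2 := norm_sub_norm_le ((1 / 2 : ℝ) • x) y
    rw [norm_smul, Real.norm_of_nonneg (by norm_num)] at h2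
    linarith
  have hle : μ (Metric.ball (0 : E) (r / 2)) ≤ ε := calc
    μ (Metric.ball (0 : E) (r / 2)) = μ (Metric.ball ((1 / 2 : ℝ) • x) (r / 2)) :=
      (Measure.addHaar_ball_center μ _ _).symm
    _ ≤ μ (Cᶜ ∩ K) := measure_mono (Set.subset_inter hsubC hsubK)
    _ = μ.restrict K Cᶜ := (Measure.restrict_apply' hKm).symm
    _ ≤ ε := hCε _ rfl
  exact hle.not_gt hεlt

/-- A convex potential `U` with `exp (-U)` integrable grows at least linearly. -/
theorem ConvexOn.exists_mul_norm_le_add {U : E → ℝ} (hU : ConvexOn ℝ Set.univ U)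
    (hint : Integrable (fun x => Real.exp (-U x)) μ) :
    ∃ a > 0, ∃ b, ∀ x, a * ‖x‖ ≤ U x + b := by
  have hcont : Continuous U := hU.locallyLipschitz.continuous
  have hbdd : Bornology.IsBounded {x | U x ≤ U 0 + 1} := by
    refine Convex.isBounded_of_measure_lt_top μ (by simpa using hU.convex_le (U 0 + 1)) ?_
      (measurableSet_le hcont.measurable measurable_const) ?_
    · filter_upwards [hcont.continuousAt.eventually_lt_const (lt_add_one (U 0))] with x hx
        using hx.le
    · refine (measure_mono fun x (hx : U x ≤ U 0 + 1) => ?_).trans_lt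
        (hint.measure_ge_lt_top (Real.exp_pos (-(U 0 + 1))))
      exact Real.exp_le_exp.2 (neg_le_neg hx)
  obtain ⟨R, hRpos, hR⟩ := hbdd.subset_ball_lt 0 0
  obtain ⟨m, hm⟩ := (isCompact_closedBall (0 : E) R).bddBelow_image hcont.continuousOn
  refine ⟨R⁻¹, inv_pos.2 hRpos, max (-U 0) (1 - m), fun x => ?_⟩
  rcases le_or_gt ‖x‖ R with hx | hx
  · have h1 : m ≤ U x := hm ⟨x, by simpa using hx, rfl⟩
    have h2 : R⁻¹ * ‖x‖ ≤ 1 := by rw [inv_mul_le_iff₀ hRpos]; linarith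
    linarith [le_max_right (-U 0) (1 - m)]
  · have hxpos : 0 < ‖x‖ := hRpos.trans hx
    set s := R / ‖x‖ with hs
    have hs0 : 0 < s := by positivity
    have hs1 : s ≤ 1 := (div_le_one hxpos).2 hx.le
    have hlarge : U 0 + 1 < U (s • x) := by
      by_contra! hle
      have h := hR hle
      rw [mem_ball_zero_iff, norm_smul, Real.norm_of_nonneg hs0.le, hs,
        div_mul_cancel₀ _ hxpos.ne'] at h
      exact lt_irrefl _ h
    have hconv := hU.2 (Set.mem_univ x) (Set.mem_univ 0) hs0.le (sub_nonneg.2 hs1) (by ring)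
    simp only [smul_zero, add_zero, smul_eq_mul] at hconv
    have h1 : 1 ≤ s * (U x - U 0) := by linarith
    have h2 : R⁻¹ * ‖x‖ = s⁻¹ := by rw [hs, inv_div]; field_simp
    have h3 : s⁻¹ ≤ U x - U 0 := by rwa [inv_le_iff_one_le_mul₀' hs0]
    linarith [le_max_left (-U 0) (1 - m)]

/-- Exponentials of negative multiples of the norm are Haar integrable. -/
theorem integrable_exp_neg_mul_norm {c : ℝ} (hc : 0 < c) :
    Integrable (fun x => Real.exp (-(c * ‖x‖))) μ := by
  set n := finrank ℝ E + 1
  have hn : (finrank ℝ E : ℝ) < (n : ℝ) := by simp [n]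
  refine ((integrable_one_add_norm (μ := μ) hn).const_mul
    (Real.exp c * n.factorial / c ^ n)).mono' (by fun_prop) (ae_of_all _ fun x => ?_)
  have ht : 0 < 1 + ‖x‖ := by positivity
  have h := Real.pow_div_factorial_le_exp (x := c * (1 + ‖x‖)) (by positivity) n
  rw [Real.norm_of_nonneg (Real.exp_pos _).le, Real.rpow_neg ht.le, Real.rpow_natCast]
  have h2 : Real.exp (-(c * ‖x‖)) = Real.exp c * (Real.exp (c * (1 + ‖x‖)))⁻¹ := by
    rw [← Real.exp_neg, ← Real.exp_add]; ring_nf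
  have h3 : Real.exp c * n.factorial / c ^ n * ((1 + ‖x‖) ^ n)⁻¹
      = Real.exp c * ((c * (1 + ‖x‖)) ^ n / n.factorial)⁻¹ := by
    rw [mul_pow]; field_simp
  rw [h2, h3]
  gcongr

/-- All powers of a linearly growing potential are integrable against `exp (-U)`. -/
theorem integrable_exp_neg_mul_pow {U : E → ℝ} (hU : Continuous U) {a b : ℝ} (ha : 0 < a)
    (hab : ∀ x, a * ‖x‖ ≤ U x + b) (k : ℕ) :
    Integrable (fun x => Real.exp (-U x) * (U x + b) ^ k) μ := by
  refine ((integrable_exp_neg_mul_norm μ (half_pos ha)).const_mul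
    (Real.exp b * (2 ^ k * k.factorial))).mono' (by fun_prop) (ae_of_all _ fun x => ?_)
  have hv : 0 ≤ U x + b := le_trans (by positivity) (hab x)
  have h := Real.pow_div_factorial_le_exp (x := (U x + b) / 2) (by positivity) k
  rw [div_pow, div_div, div_le_iff₀ (by positivity)] at h
  rw [Real.norm_of_nonneg (by positivity)]
  calc Real.exp (-U x) * (U x + b) ^ k
      ≤ Real.exp (-U x) * (Real.exp ((U x + b) / 2) * (2 ^ k * k.factorial)) := by gcongr
    _ = Real.exp b * (2 ^ k * k.factorial) * Real.exp (-((U x + b) / 2)) := by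
        have : Real.exp (-U x) * Real.exp ((U x + b) / 2)
            = Real.exp b * Real.exp (-((U x + b) / 2)) := by
          rw [← Real.exp_add, ← Real.exp_add]; ring_nf
        linear_combination (2 ^ k * k.factorial : ℝ) * this
    _ ≤ Real.exp b * (2 ^ k * k.factorial) * Real.exp (-(a / 2 * ‖x‖)) := by
        gcongr
        linarith [hab x]

end Growth

/-- For convex `U` with `∫ exp(-U) < ∞` and `μ*` the probability measure with
density `exp(-U)/Z`: (i) `μ*` has finite second moment; (ii) `∫ U dμ*` and `H(μ*)` are finite;
(iii) for every probability measure `ρ` with finite second moment, `ρ ≪ λ` and `U` `ρ`-integrable,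
`KL(ρ | μ*) = (∫ U dρ + H(ρ)) - (∫ U dμ* + H(μ*))` as extended reals. -/
theorem kl_eq_energy_add_entropy_sub
    (d : ℕ) (hd : 1 ≤ d)
    (U : EuclideanSpace ℝ (Fin d) → ℝ) (hU : ConvexOn ℝ Set.univ U)
    (hUint : Integrable (fun x => Real.exp (-U x)) volume)
    (μstar : Measure (EuclideanSpace ℝ (Fin d)))
    (hμstar : μstar = volume.withDensity
      (fun x => ENNReal.ofReal (Real.exp (-U x) / ∫ y, Real.exp (-U y)))) :
    Integrable (fun x => ‖x‖ ^ 2) μstar ∧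
    (Integrable U μstar ∧
      Integrable (fun x => Real.log ((μstar.rnDeriv volume x).toReal)) μstar) ∧
    (∀ ρ : Measure (EuclideanSpace ℝ (Fin d)), IsProbabilityMeasure ρ →
      Integrable (fun x => ‖x‖ ^ 2) ρ → ρ ≪ volume → Integrable U ρ →
      klE ρ μstar =
        (((∫ x, U x ∂ρ : ℝ) : EReal) + entropyE ρ)
          - (((∫ x, U x ∂μstar : ℝ) : EReal) + entropyE μstar)) := by
  have hcont : Continuous U := hU.locallyLipschitz.continuous
  replace hμstar : μstar = volume.tilted (fun x => -U x) := hμstar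
  subst hμstar
  have : IsProbabilityMeasure (volume.tilted (fun x => -U x)) := isProbabilityMeasure_tilted hUint
  obtain ⟨a, ha, b, hab⟩ := hU.exists_mul_norm_le_add volume hUint
  have hsecond : Integrable (fun x => ‖x‖ ^ 2) (volume.tilted (fun x => -U x)) := by
    rw [integrable_tilted_iff hUint]
    refine ((integrable_exp_neg_mul_pow volume hcont ha hab 2).const_mul (a ^ 2)⁻¹).mono'
      (by fun_prop) (ae_of_all _ fun x => ?_)
    have h : (a * ‖x‖) ^ 2 ≤ (U x + b) ^ 2 := by gcongr; exact hab x
    rw [smul_eq_mul, Real.norm_of_nonneg (by positivity), mul_left_comm]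
    gcongr
    rwa [le_inv_mul_iff₀ (by positivity), ← mul_pow]
  have henergy : Integrable U (volume.tilted (fun x => -U x)) := by
    rw [integrable_tilted_iff hUint]
    refine ((integrable_exp_neg_mul_pow volume hcont ha hab 1).sub
      (hUint.const_mul b)).congr (ae_of_all _ fun x => ?_)
    simp only [Pi.sub_apply, smul_eq_mul]
    ring
  have hlog := (tilted_absolutelyContinuous volume (fun x => -U x)).ae_eq
    (log_rnDeriv_tilted_left_self hUint)
  have hentropy := (integrable_congr hlog).2 (henergy.neg.sub (integrable_const _))
  refine ⟨hsecond, ⟨henergy, hentropy⟩, fun ρ hρ _ hac hUρ => ?_⟩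
  have hstar : ((∫ x, U x ∂(volume.tilted fun x => -U x) : ℝ) : EReal)
      + entropyE (volume.tilted fun x => -U x)
      = ((-Real.log (∫ x, Real.exp (-U x)) : ℝ) : EReal) := by
    rw [entropyE, if_pos hentropy, integral_congr_ae hlog,
      integral_sub henergy.fun_neg (integrable_const _), integral_neg, ← EReal.coe_add,
      EReal.coe_eq_coe_iff, integral_const, probReal_univ, one_smul]
    ring
  have hllr := llr_tilted_right hac hUint
  have hiff : Integrable (fun x => Real.log (ρ.rnDeriv (volume.tilted fun x => -U x) x).toReal) ρ
      ↔ Integrable (fun x => Real.log (ρ.rnDeriv volume x).toReal) ρ := by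
    refine (integrable_congr hllr).trans ?_
    exact integrable_add_iff_integrable_right (hUρ.neg.neg.add (integrable_const _))
  rw [hstar, klE, entropyE]
  by_cases hρint : Integrable (fun x => Real.log (ρ.rnDeriv volume x).toReal) ρ
  · rw [if_pos ⟨hac.trans (absolutelyContinuous_tilted hUint), hiff.2 hρint⟩, if_pos hρint,
      ← EReal.coe_add, ← EReal.coe_sub, EReal.coe_eq_coe_iff]
    have h := integral_llr_tilted_right hac hUρ.fun_neg hUint hρint
    simp only [llr, integral_neg] at h
    linarith
  · rw [if_neg fun h => hρint (hiff.1 h.2), if_neg hρint, EReal.coe_add_top, EReal.top_sub_coe]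
end

section
/- Let α > 0 and γ > 0 with 0 < γα < 1, let B ≥ 0 and k ∈ ℕ. Let W₀, …, W_{k+1} be nonnegative reals and K₀, …, K_k be reals satisfying 2γ K_j ≤ (1 − γα) W_j − W_{j+1} + γ² B for every j = 0, …, k. Write q := 1 − γα. Then ( Σ_{j=0}^{k} q^{−j} K_j ) / ( Σ_{j=0}^{k} q^{−j} ) ≤ (α W₀ / 2) · q^{k+1} / (1 − q^{k+1}) + γB/2. -/
/-- Partial sums of the geometric series with ratio `q⁻¹`, cleared of negative powers. -/
theorem pow_mul_one_sub_mul_sum_zpow_neg {q : ℝ} (hq : q ≠ 0) (n : ℕ) :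
    q ^ n * (1 - q) * ∑ j ∈ Finset.range n, q ^ (-(j : ℤ)) = q * (1 - q ^ n) := by
  induction n with
  | zero => simp
  | succ n ih =>
    have hn : q ^ n * q ^ (-(n : ℤ)) = 1 := by
      rw [zpow_neg, zpow_natCast, mul_inv_cancel₀ (pow_ne_zero n hq)]
    rw [Finset.sum_range_succ, pow_succ]
    linear_combination q * ih + q * (1 - q) * hn

/-- Weighting the inequalities `c K_j ≤ q W_j - W_{j+1} + D` by `q^{-j}` makes them telescope. -/
theorem mul_sum_zpow_neg_mul_le {q c D : ℝ} (hq : 0 < q) {W K : ℕ → ℝ} (n : ℕ)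
    (h : ∀ j < n, c * K j ≤ q * W j - W (j + 1) + D) :
    c * ∑ j ∈ Finset.range n, q ^ (-(j : ℤ)) * K j ≤
      q * W 0 - q * q ^ (-(n : ℤ)) * W n + D * ∑ j ∈ Finset.range n, q ^ (-(j : ℤ)) := by
  induction n with
  | zero => simp
  | succ n ih =>
    have hn : q * q ^ (-((n + 1 : ℕ) : ℤ)) = q ^ (-(n : ℤ)) := by
      rw [← zpow_one_add₀ hq.ne']
      congr 1
      push_cast
      ring
    have hstep := mul_le_mul_of_nonneg_left (h n n.lt_succ_self) (zpow_pos hq (-(n : ℤ))).le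
    rw [Finset.sum_range_succ, Finset.sum_range_succ, hn]
    linarith [ih fun j hj => h j (hj.trans n.lt_succ_self)]

/-- Geometrically weighted average of the one-step inequalities: if
`2γ K_j ≤ (1 - γα) W_j - W_{j+1} + γ² B` for `j = 0, …, k` with `W_j ≥ 0`, and `q := 1 - γα`
with `0 < γα < 1`, then
`(Σ_{j=0}^k q^{-j} K_j) / (Σ_{j=0}^k q^{-j}) ≤ (α W₀/2) · q^{k+1}/(1 - q^{k+1}) + γB/2`. -/
theorem weighted_avg_le_of_contracting_bound
    (α γ : ℝ) (hα : 0 < α) (hγ : 0 < γ) (hγα0 : 0 < γ * α) (hγα1 : γ * α < 1)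
    (B : ℝ) (hB : 0 ≤ B) (k : ℕ)
    (W K : ℕ → ℝ)
    (hW : ∀ j ≤ k + 1, 0 ≤ W j)
    (h : ∀ j ≤ k, 2 * γ * K j ≤ (1 - γ * α) * W j - W (j + 1) + γ ^ 2 * B) :
    (∑ j ∈ Finset.range (k + 1), (1 - γ * α) ^ (-(j : ℤ)) * K j) /
        (∑ j ∈ Finset.range (k + 1), (1 - γ * α) ^ (-(j : ℤ))) ≤
      α * W 0 / 2 * ((1 - γ * α) ^ (k + 1) / (1 - (1 - γ * α) ^ (k + 1))) + γ * B / 2 := by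
  have hq : 0 < 1 - γ * α := by linarith
  have hsum := mul_sum_zpow_neg_mul_le hq (k + 1) fun j hj => h j (Nat.lt_succ_iff.mp hj)
  have hgeom := pow_mul_one_sub_mul_sum_zpow_neg hq.ne' (k + 1)
  have hpow : (1 - γ * α) ^ (k + 1) < 1 := pow_lt_one₀ hq.le (by linarith) k.succ_ne_zero
  have hlast : 0 ≤ (1 - γ * α) * (1 - γ * α) ^ (-((k + 1 : ℕ) : ℤ)) * W (k + 1) :=
    mul_nonneg (mul_pos hq (zpow_pos hq _)).le (hW _ le_rfl)
  have hS : 0 < ∑ j ∈ Finset.range (k + 1), (1 - γ * α) ^ (-(j : ℤ)) :=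
    Finset.sum_pos (fun j _ => zpow_pos hq _) Finset.nonempty_range_add_one
  generalize ∑ j ∈ Finset.range (k + 1), (1 - γ * α) ^ (-(j : ℤ)) = S at *
  generalize ∑ j ∈ Finset.range (k + 1), (1 - γ * α) ^ (-(j : ℤ)) * K j = N at *
  generalize (1 - γ * α) ^ (k + 1) = Q at *
  have hQ : 1 - Q ≠ 0 := by linarith
  have hratio : γ * α * (Q / (1 - Q) * S) = 1 - γ * α := by
    field_simp
    linear_combination hgeom
  rw [div_le_iff₀ hS]
  refine le_of_mul_le_mul_left ?_ (by positivity : 0 < 2 * γ)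
  calc 2 * γ * N ≤ (1 - γ * α) * W 0 + γ ^ 2 * B * S := by linarith
    _ = 2 * γ * ((α * W 0 / 2 * (Q / (1 - Q)) + γ * B / 2) * S) := by
      linear_combination -W 0 * hratio
end
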